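/- Let A be a unital algebra over ℂ and X a complex vector space. If φ : A × A → X is a bilinear map such that φ(A, B) = 0 whenever AB = BA = 0, then for every A ∈ A and every J in the subalgebra generated by the idempotents of A, φ(A, J) + φ(J, A) = φ(AJ, 1) + φ(1, JA). -/

import Mathlib

section

variable {A X : Type*} [Ring A] [Algebra ℂ A] [AddCommGroup X] [Module ℂ X]

/-- For an idempotent `P`, a bilinear map vanishing on two-sided zero products relates its values
on the corner `P A (1 - P)`. -/
lemma map_corner_idempotent (φ : A →ₗ[ℂ] A →ₗ[ℂ] X)
    (h : ∀ a b : A, a * b = 0 → b * a = 0 → φ a b = 0) {P : A} (hP : P * P = P) (a : A) :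
    φ (P * a * (1 - P)) P = φ (1 - P) (P * a * (1 - P)) := by
  have hP' (z : A) : P * (P * z) = P * z := by rw [← mul_assoc, hP]
  obtain ⟨x, hx⟩ : ∃ x, x = P * a * (1 - P) := ⟨_, rfl⟩
  have hPx : P * x = x := by simp [hx, mul_assoc, hP']
  have hxP : x * P = 0 := by simp [hx, mul_assoc, sub_mul, hP]
  have hxx : x * x = 0 := by rw [← hPx, mul_assoc, ← mul_assoc x, hxP, zero_mul, mul_zero]
  have h₁ := h (1 - P - x) (P + x) (by simp [sub_mul, mul_add, hP, hPx, hxP, hxx])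
    (by simp [mul_sub, add_mul, hP, hPx, hxP, hxx])
  have h₂ := h (1 - P) P (by simp [sub_mul, hP]) (by simp [mul_sub, hP])
  have h₃ := h x x hxx hxx
  rw [← hx]
  rw [map_sub, LinearMap.sub_apply, map_add, map_add, h₂, h₃, zero_add, add_zero] at h₁
  exact (sub_eq_zero.mp h₁).symm

lemma map_idempotent_add_map_idempotent (φ : A →ₗ[ℂ] A →ₗ[ℂ] X)
    (h : ∀ a b : A, a * b = 0 → b * a = 0 → φ a b = 0) {P : A} (hP : P * P = P) (a : A) :
    φ a P + φ P a = φ (a * P) 1 + φ 1 (P * a) := by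
  have hP' (z : A) : P * (P * z) = P * z := by rw [← mul_assoc, hP]
  have hQ : (1 - P) * (1 - P) = 1 - P := by simp [mul_sub, sub_mul, hP]
  have h₁ := map_corner_idempotent φ h hP a
  have h₂ := map_corner_idempotent φ h hQ a
  have h₃ := h ((1 - P) * a * (1 - P)) P (by simp [mul_sub, sub_mul, mul_assoc, hP])
    (by simp [mul_sub, sub_mul, mul_assoc, hP'])
  have h₄ := h P ((1 - P) * a * (1 - P)) (by simp [mul_sub, sub_mul, mul_assoc, hP'])
    (by simp [mul_sub, sub_mul, mul_assoc, hP])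
  have h₅ := h (P * a * P) (1 - P) (by simp [mul_sub, mul_assoc, hP])
    (by simp [sub_mul, mul_assoc, hP'])
  have h₆ := h (1 - P) (P * a * P) (by simp [sub_mul, mul_assoc, hP'])
    (by simp [mul_sub, mul_assoc, hP])
  simp only [mul_sub, sub_mul, mul_one, one_mul, mul_assoc, map_sub, LinearMap.sub_apply,
    sub_sub_cancel] at h₁ h₂ h₃ h₄ h₅ h₆ ⊢
  linear_combination (norm := module) h₁ - h₂ + h₃ + h₄ - h₅ - h₆

lemma map_mul_sub_map_mul_of_idempotent (φ : A →ₗ[ℂ] A →ₗ[ℂ] X)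
    (h : ∀ a b : A, a * b = 0 → b * a = 0 → φ a b = 0) {e f : A} (he : e * e = e)
    (hf : f * f = f) (a b : A) :
    φ (a * f) (b * e) - φ a (f * (b * e)) = φ (e * a * f) b - φ (e * a) (f * b) := by
  have key {e f : A} (he : e * e = e) (hf : f * f = f) :
      φ (e * a * f) ((1 - f) * b * (1 - e)) = 0 := by
    have he' : (1 - e) * e = 0 := by simp [sub_mul, he]
    have hf' : f * (1 - f) = 0 := by simp [mul_sub, hf]
    apply h
    · calc _ = e * a * (f * (1 - f)) * b * (1 - e) := by simp only [mul_assoc]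
        _ = 0 := by simp [hf']
    · calc _ = (1 - f) * b * ((1 - e) * e) * a * f := by simp only [mul_assoc]
        _ = 0 := by simp [he']
  have he₁ : (1 - e) * (1 - e) = 1 - e := by simp [mul_sub, sub_mul, he]
  have hf₁ : (1 - f) * (1 - f) = 1 - f := by simp [mul_sub, sub_mul, hf]
  have h₁ := key he hf
  have h₂ := key he₁ hf
  have h₃ := key he hf₁
  have h₄ := key he₁ hf₁
  simp only [mul_sub, sub_mul, mul_one, one_mul, mul_assoc, map_sub, LinearMap.sub_apply,
    sub_sub_cancel] at h₁ h₂ h₃ h₄ ⊢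
  linear_combination (norm := module) h₂ - h₁ + h₃ - h₄

lemma map_mul_sub_map_mul_of_mem_closure (φ : A →ₗ[ℂ] A →ₗ[ℂ] X)
    (h : ∀ a b : A, a * b = 0 → b * a = 0 → φ a b = 0) {w f : A}
    (hw : w ∈ Subring.closure {P : A | P * P = P})
    (hf : f ∈ Subring.closure {P : A | P * P = P}) (a b : A) :
    φ (a * f) (b * w) - φ a (f * (b * w)) = φ (w * a * f) b - φ (w * a) (f * b) := by
  induction hf using Subring.closure_induction generalizing a b with
  | mem f hf =>
    induction hw using Subring.closure_induction generalizing a b with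
    | mem e he => exact map_mul_sub_map_mul_of_idempotent φ h he hf a b
    | zero => simp
    | one => simp
    | add x y _ _ hx hy =>
      have h₁ := hx a b
      have h₂ := hy a b
      simp only [mul_add, add_mul, map_add, LinearMap.add_apply]
      linear_combination (norm := module) h₁ + h₂
    | neg x _ hx =>
      have h₁ := hx a b
      simp only [mul_neg, neg_mul, map_neg, LinearMap.neg_apply]
      linear_combination (norm := module) -h₁
    | mul x y _ _ hx hy =>
      have h₁ := hx (y * a) b
      have h₂ := hy a (b * x)
      simp only [mul_assoc] at h₁ h₂ ⊢
      exact h₂.trans h₁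
  | zero => simp
  | one => simp
  | add x y _ _ hx hy =>
    have h₁ := hx a b
    have h₂ := hy a b
    simp only [mul_add, add_mul, map_add, LinearMap.add_apply]
    linear_combination (norm := module) h₁ + h₂
  | neg x _ hx =>
    have h₁ := hx a b
    simp only [mul_neg, neg_mul, map_neg, LinearMap.neg_apply]
    linear_combination (norm := module) -h₁
  | mul x y _ _ hx hy =>
    have h₁ := hx a (y * b)
    have h₂ := hy (a * x) b
    simp only [mul_assoc] at h₁ h₂ ⊢
    linear_combination (norm := module) h₁ + h₂

end

/-- A bilinear map vanishing on pairs with zero products satisfies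
`φ(A,J) + φ(J,A) = φ(AJ,1) + φ(1,JA)` for `J` in the subring generated by idempotents. -/
theorem bilinear_zero_product_identity_idempotent_subring
    {A X : Type*} [Ring A] [Algebra ℂ A] [AddCommGroup X] [Module ℂ X]
    (φ : A →ₗ[ℂ] A →ₗ[ℂ] X)
    (h : ∀ a b : A, a * b = 0 → b * a = 0 → φ a b = 0)
    (a : A) (J : A) (hJ : J ∈ Subring.closure {P : A | P * P = P}) :
    φ a J + φ J a = φ (a * J) 1 + φ 1 (J * a) := by
  induction hJ using Subring.closure_induction generalizing a with
  | mem P hP => exact map_idempotent_add_map_idempotent φ h hP a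
  | zero => simp
  | one => simp
  | add x y _ _ hx hy =>
    have h₁ := hx a
    have h₂ := hy a
    simp only [mul_add, add_mul, map_add, LinearMap.add_apply]
    linear_combination (norm := module) h₁ + h₂
  | neg x _ hx =>
    have h₁ := hx a
    simp only [mul_neg, neg_mul, map_neg, LinearMap.neg_apply]
    linear_combination (norm := module) -h₁
  | mul x y hxS hyS hx hy =>
    have h₁ := map_mul_sub_map_mul_of_mem_closure φ h hyS hxS a 1
    have h₂ := map_mul_sub_map_mul_of_mem_closure φ h hxS hyS 1 a
    have h₃ := hx (y * a)
    have h₄ := hy (a * x)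
    simp only [mul_assoc, mul_one, one_mul] at h₁ h₂ h₃ h₄ ⊢
    linear_combination (norm := module) h₃ + h₄ - h₁ - h₂
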